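/- Let q ≥ 1 and n ≥ 2 be integers and let X be a connected (q+1)-regular simple undirected graph on n vertices. For every integer k ≥ 1, H_k = 2(n−1) − Σ_{i=2}^{n} T_k(q^{−1/2} λ_i). -/

import Mathlib

open Matrix Filter

noncomputable section

/-- The non-backtracking (Hashimoto) matrix of a graph, indexed by darts:
`W e f = 1` if the end of `e` is the start of `f` and `f` is not the reversal of `e`. -/
def hashimoto {n : ℕ} (X : SimpleGraph (Fin n)) [DecidableRel X.Adj] :
    Matrix X.Dart X.Dart ℝ :=
  Matrix.of fun e f => if e.toProd.2 = f.toProd.1 ∧ f ≠ e.symm then 1 else 0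

/-- `N_k = trace(W^k)`, the number of geodesic cycles of length `k`. -/
def Ngc {n : ℕ} (X : SimpleGraph (Fin n)) [DecidableRel X.Adj] (k : ℕ) : ℝ :=
  (hashimoto X ^ k).trace

/-- The sequence `H_k`. -/
def Hseq (q : ℕ) {n : ℕ} (X : SimpleGraph (Fin n)) [DecidableRel X.Adj] (k : ℕ) : ℝ :=
  if Odd k then
    2 * ((n : ℝ) - 1) + Real.sqrt q ^ k + (Real.sqrt q ^ k)⁻¹
      - (Real.sqrt q ^ k)⁻¹ * Ngc X k
  else
    2 * ((n : ℝ) - 1) + Real.sqrt q ^ k + (Real.sqrt q ^ k)⁻¹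
      - (Real.sqrt q ^ k)⁻¹ * (Ngc X k - (n : ℝ) * ((q : ℝ) - 1))

/-- `μ(X) = q^{-1/2} · max_{2 ≤ i ≤ n} |λ_i|`, where `lam` enumerates the eigenvalues
in decreasing order (indices starting from `0`). -/
def mu (q : ℕ) {n : ℕ} (lam : Fin n → ℝ) : ℝ :=
  (Real.sqrt q)⁻¹ * sSup {x : ℝ | ∃ i : Fin n, (i : ℕ) ≠ 0 ∧ x = |lam i|}

/-- The polynomials `T_k`: `T_0(x) = 2`, `T_1(x) = x`, `T_{k+1}(x) = x·T_k(x) − T_{k−1}(x)`. -/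
def Tk : ℕ → ℝ → ℝ
  | 0, _ => 2
  | 1, x => x
  | (k + 2), x => x * Tk (k + 1) x - Tk k x

/-- The normalised Chebyshev-type recursion `p₀ = 2`, `p₁ = a`, `pₖ₊₂ = a pₖ₊₁ - q pₖ`
evaluated at an element of a ring. -/
def chebRec {R : Type*} [Ring R] (q : ℕ) (a : R) : ℕ → R
  | 0 => 2
  | 1 => a
  | (k + 2) => a * chebRec q a (k + 1) - q * chebRec q a k

lemma chebRec_eq_sqrt_pow_mul_Tk {q : ℕ} (hq : 1 ≤ q) (x : ℝ) (k : ℕ) :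
    chebRec q x k = Real.sqrt q ^ k * Tk k ((Real.sqrt q)⁻¹ * x) := by
  have hs : Real.sqrt q ≠ 0 := by
    have : (0 : ℝ) < q := by exact_mod_cast hq
    positivity
  have hsq : Real.sqrt q ^ 2 = q := Real.sq_sqrt (Nat.cast_nonneg q)
  induction k using Nat.twoStepInduction with
  | zero => simp [chebRec, Tk]
  | one => simp [chebRec, Tk, hs]
  | more k ih₀ ih₁ =>
    rw [chebRec, Tk, ih₀, ih₁, ← hsq]
    simp only [Real.sqrt_sq (Real.sqrt_nonneg _)]
    field_simp
    ring

lemma chebRec_natCast_add_one (q : ℕ) (k : ℕ) :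
    chebRec q ((q : ℝ) + 1) k = (q : ℝ) ^ k + 1 := by
  induction k using Nat.twoStepInduction with
  | zero => norm_num [chebRec]
  | one => simp [chebRec]
  | more k ih₀ ih₁ => rw [chebRec, ih₀, ih₁]; ring

lemma chebRec_diagonal {m : Type*} [Fintype m] [DecidableEq m] (q : ℕ) (d : m → ℝ) (k : ℕ) :
    chebRec q (diagonal d) k = diagonal fun i => chebRec q (d i) k := by
  induction k using Nat.twoStepInduction with
  | zero => exact (diagonal_ofNat' 2).symm
  | one => rfl
  | more k ih₀ ih₁ =>
    simp only [chebRec, ih₀, ih₁]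
    rw [← diagonal_natCast', diagonal_mul_diagonal, diagonal_mul_diagonal, diagonal_sub]
    rfl

lemma map_chebRec {R S F : Type*} [Ring R] [Ring S] [FunLike F R S] [RingHomClass F R S]
    (f : F) (q : ℕ) (a : R) (k : ℕ) : f (chebRec q a k) = chebRec q (f a) k := by
  induction k using Nat.twoStepInduction with
  | zero => exact map_ofNat f 2
  | one => rfl
  | more k ih₀ ih₁ => simp [chebRec, ih₀, ih₁]

lemma trace_chebRec_eq_sum {m : Type*} [Fintype m] [DecidableEq m] {A : Matrix m m ℝ}
    (hA : A.IsHermitian) (q k : ℕ) :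
    (chebRec q A k).trace = ∑ i, chebRec q (hA.eigenvalues i) k := by
  conv_lhs => rw [hA.spectral_theorem]
  rw [← map_chebRec, chebRec_diagonal, Unitary.conjStarAlgAut_apply, Matrix.trace_mul_cycle]
  simp [Matrix.trace]

section Hashimoto

variable {n : ℕ} (X : SimpleGraph (Fin n))

/-- The permutation matrix of dart reversal. -/
def reversalMatrix : Matrix X.Dart X.Dart ℝ :=
  Matrix.of fun e f => if f = e.symm then 1 else 0

variable {X} in
lemma dart_eq_symm_comm (e f : X.Dart) : e = f.symm ↔ f = e.symm := by
  constructor <;> rintro rfl <;> simp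

lemma transpose_reversalMatrix : (reversalMatrix X)ᵀ = reversalMatrix X := by
  ext e f
  simp [reversalMatrix, dart_eq_symm_comm e f]

variable [DecidableRel X.Adj]

/-- Incidence matrix between vertices and the darts starting there. -/
def startMatrix : Matrix (Fin n) X.Dart ℝ :=
  Matrix.of fun v e => if e.toProd.1 = v then 1 else 0

/-- Incidence matrix between vertices and the darts ending there. -/
def endMatrix : Matrix (Fin n) X.Dart ℝ :=
  Matrix.of fun v e => if e.toProd.2 = v then 1 else 0

lemma hashimoto_eq :
    hashimoto X = (endMatrix X)ᵀ * startMatrix X - reversalMatrix X := by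
  ext e f
  simp only [hashimoto, endMatrix, startMatrix, reversalMatrix, Matrix.sub_apply, mul_apply,
    transpose_apply, of_apply]
  by_cases h : f = e.symm
  · subst h; simp
  · simp [h, eq_comm]

lemma reversalMatrix_mul_self : reversalMatrix X * reversalMatrix X = 1 := by
  ext e f
  simp [reversalMatrix, mul_apply, one_apply, dart_eq_symm_comm f,
    SimpleGraph.Dart.symm_involutive.injective.eq_iff, eq_comm]

lemma startMatrix_mul_reversalMatrix : startMatrix X * reversalMatrix X = endMatrix X := by
  ext v e
  simp [reversalMatrix, startMatrix, endMatrix, mul_apply, dart_eq_symm_comm e]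

lemma endMatrix_mul_reversalMatrix : endMatrix X * reversalMatrix X = startMatrix X := by
  rw [← startMatrix_mul_reversalMatrix, Matrix.mul_assoc, reversalMatrix_mul_self, Matrix.mul_one]

lemma reversalMatrix_mul_transpose_endMatrix :
    reversalMatrix X * (endMatrix X)ᵀ = (startMatrix X)ᵀ := by
  rw [← endMatrix_mul_reversalMatrix, transpose_mul, transpose_reversalMatrix]

lemma startMatrix_mul_transpose_endMatrix :
    startMatrix X * (endMatrix X)ᵀ = X.adjMatrix ℝ := by
  ext v w
  simp only [startMatrix, endMatrix, mul_apply, transpose_apply, of_apply,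
    SimpleGraph.adjMatrix_apply, ← ite_and, mul_ite, mul_one, mul_zero]
  by_cases h : X.Adj v w
  · rw [Finset.sum_eq_single ⟨(v, w), h⟩]
    · simp [h]
    · rintro ⟨⟨a, b⟩, hab⟩ - hne
      rw [if_neg]
      rintro ⟨rfl, rfl⟩
      exact hne rfl
    · simp
  · rw [if_neg h]
    refine Finset.sum_eq_zero fun e _ => if_neg ?_
    rintro ⟨rfl, rfl⟩
    exact h e.adj

variable {X}

lemma startMatrix_mul_transpose_self {d : ℕ} (hreg : X.IsRegularOfDegree d) :
    startMatrix X * (startMatrix X)ᵀ = (d : Matrix (Fin n) (Fin n) ℝ) := by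
  ext v w
  rw [← diagonal_natCast', diagonal_apply]
  simp only [startMatrix, mul_apply, transpose_apply, of_apply, ← ite_and, mul_ite, mul_one,
    mul_zero]
  split_ifs with h
  · subst h
    simp only [and_self, Finset.sum_boole, Pi.natCast_apply]
    exact_mod_cast (X.dart_fst_fiber_card_eq_degree v).trans (hreg v)
  · refine Finset.sum_eq_zero fun e _ => if_neg ?_
    rintro ⟨rfl, rfl⟩
    exact h rfl

lemma endMatrix_mul_transpose_self {d : ℕ} (hreg : X.IsRegularOfDegree d) :
    endMatrix X * (endMatrix X)ᵀ = (d : Matrix (Fin n) (Fin n) ℝ) := by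
  rw [← startMatrix_mul_transpose_self hreg, ← startMatrix_mul_reversalMatrix, transpose_mul,
    transpose_reversalMatrix, Matrix.mul_assoc, ← Matrix.mul_assoc (reversalMatrix X),
    reversalMatrix_mul_self, Matrix.one_mul]

lemma startMatrix_mul_hashimoto :
    startMatrix X * hashimoto X = X.adjMatrix ℝ * startMatrix X - endMatrix X := by
  rw [hashimoto_eq, Matrix.mul_sub, ← Matrix.mul_assoc, startMatrix_mul_transpose_endMatrix,
    startMatrix_mul_reversalMatrix]

lemma endMatrix_mul_hashimoto {q : ℕ} (hreg : X.IsRegularOfDegree (q + 1)) :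
    endMatrix X * hashimoto X = (q : Matrix (Fin n) (Fin n) ℝ) * startMatrix X := by
  rw [hashimoto_eq, Matrix.mul_sub, ← Matrix.mul_assoc, endMatrix_mul_transpose_self hreg,
    endMatrix_mul_reversalMatrix, Nat.cast_succ, Matrix.add_mul, Matrix.one_mul, add_sub_cancel_right]

lemma startMatrix_mul_hashimoto_pow_add_two {q : ℕ} (hreg : X.IsRegularOfDegree (q + 1)) (k : ℕ) :
    startMatrix X * hashimoto X ^ (k + 2) =
      X.adjMatrix ℝ * (startMatrix X * hashimoto X ^ (k + 1)) -
        (q : Matrix (Fin n) (Fin n) ℝ) * (startMatrix X * hashimoto X ^ k) := by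
  rw [pow_succ' _ (k + 1), ← Matrix.mul_assoc, startMatrix_mul_hashimoto, Matrix.sub_mul,
    Matrix.mul_assoc, pow_succ' _ k, ← Matrix.mul_assoc (endMatrix X),
    endMatrix_mul_hashimoto hreg, Matrix.mul_assoc (q : Matrix (Fin n) (Fin n) ℝ)]

lemma chebRec_adjMatrix_sub {q : ℕ} (hreg : X.IsRegularOfDegree (q + 1)) (k : ℕ) :
    startMatrix X * hashimoto X ^ (k + 1) * (endMatrix X)ᵀ -
        startMatrix X * hashimoto X ^ k * (startMatrix X)ᵀ =
      chebRec q (X.adjMatrix ℝ) (k + 2) - chebRec q (X.adjMatrix ℝ) k := by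
  have hqA := Nat.cast_commute q (X.adjMatrix ℝ)
  have hES : endMatrix X * (startMatrix X)ᵀ = X.adjMatrix ℝ := by
    rw [← (X.isSymm_adjMatrix (α := ℝ)).eq, ← startMatrix_mul_transpose_endMatrix, transpose_mul,
      transpose_transpose]
  have h₀ : startMatrix X * hashimoto X ^ 1 * (endMatrix X)ᵀ =
      X.adjMatrix ℝ * X.adjMatrix ℝ - ((q : Matrix (Fin n) (Fin n) ℝ) + 1) := by
    rw [pow_one, startMatrix_mul_hashimoto, Matrix.sub_mul, Matrix.mul_assoc,
      startMatrix_mul_transpose_endMatrix, endMatrix_mul_transpose_self hreg, Nat.cast_succ]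
  induction k using Nat.twoStepInduction with
  | zero =>
    rw [zero_add, h₀, pow_zero, Matrix.mul_one, startMatrix_mul_transpose_self hreg]
    simp only [chebRec, Nat.cast_succ, ← one_add_one_eq_two]
    noncomm_ring
  | one =>
    rw [startMatrix_mul_hashimoto_pow_add_two hreg, Matrix.sub_mul, Matrix.mul_assoc, zero_add, h₀,
      pow_zero, Matrix.mul_one, Matrix.mul_assoc (q : Matrix (Fin n) (Fin n) ℝ),
      startMatrix_mul_transpose_endMatrix, pow_one, startMatrix_mul_hashimoto, Matrix.sub_mul,
      Matrix.mul_assoc, startMatrix_mul_transpose_self hreg, hES]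
    simp only [chebRec, Nat.cast_succ, ← one_add_one_eq_two, mul_sub, mul_add, mul_one, ← hqA.eq]
    noncomm_ring
  | more k ih₀ ih₁ =>
    have hrec {m : Type} (B : Matrix X.Dart m ℝ) (l : ℕ) :
        startMatrix X * hashimoto X ^ (l + 2) * B =
          X.adjMatrix ℝ * (startMatrix X * hashimoto X ^ (l + 1) * B) -
            (q : Matrix (Fin n) (Fin n) ℝ) * (startMatrix X * hashimoto X ^ l * B) := by
      rw [startMatrix_mul_hashimoto_pow_add_two hreg, Matrix.sub_mul, Matrix.mul_assoc,
        Matrix.mul_assoc (q : Matrix (Fin n) (Fin n) ℝ)]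
    rw [hrec (endMatrix X)ᵀ (k + 1), hrec (startMatrix X)ᵀ k, sub_sub_sub_comm,
      ← Matrix.mul_sub, ← Matrix.mul_sub, ih₀, ih₁,
      chebRec.eq_3 q _ (k + 2), chebRec.eq_3 q _ k, Matrix.mul_sub, Matrix.mul_sub,
      sub_sub_sub_comm]

lemma trace_hashimoto_pow_add_two (k : ℕ) :
    (hashimoto X ^ (k + 2)).trace =
      (startMatrix X * hashimoto X ^ (k + 1) * (endMatrix X)ᵀ -
        startMatrix X * hashimoto X ^ k * (startMatrix X)ᵀ).trace + (hashimoto X ^ k).trace := by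
  have h : reversalMatrix X * hashimoto X ^ (k + 1) =
      (startMatrix X)ᵀ * (startMatrix X * hashimoto X ^ k) - hashimoto X ^ k := by
    rw [pow_succ', ← Matrix.mul_assoc]
    nth_rw 1 [hashimoto_eq]
    rw [Matrix.mul_sub, reversalMatrix_mul_self, ← Matrix.mul_assoc,
      reversalMatrix_mul_transpose_endMatrix, Matrix.sub_mul, Matrix.one_mul, Matrix.mul_assoc]
  rw [pow_succ' _ (k + 1)]
  nth_rw 1 [hashimoto_eq]
  rw [Matrix.sub_mul, h, Matrix.mul_assoc]
  simp only [trace_sub]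
  rw [trace_mul_comm (endMatrix X)ᵀ, trace_mul_comm (startMatrix X)ᵀ]
  ring

lemma trace_hashimoto_pow {q : ℕ} (hreg : X.IsRegularOfDegree (q + 1)) (k : ℕ) :
    (hashimoto X ^ k).trace = (chebRec q (X.adjMatrix ℝ) k).trace +
      if Odd k then 0 else (n : ℝ) * ((q : ℝ) - 1) := by
  induction k using Nat.twoStepInduction with
  | zero =>
    have hD : Fintype.card X.Dart = n * (q + 1) := by
      rw [X.dart_card_eq_sum_degrees, Finset.sum_congr rfl fun v _ => hreg v]
      simp
    have h2 : (2 : Matrix (Fin n) (Fin n) ℝ).trace = 2 * n := by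
      rw [← one_add_one_eq_two, trace_add, trace_one]
      simp [two_mul]
    simp only [pow_zero, trace_one, hD, chebRec, h2]
    simp
    ring
  | one =>
    have h (e : X.Dart) : e.toProd.2 ≠ e.toProd.1 := e.adj.ne'
    simp [chebRec, Matrix.trace, hashimoto, h]
  | more k ih₀ _ =>
    have hodd : Odd (k + 2) ↔ Odd k := by simp [Nat.odd_add]
    rw [trace_hashimoto_pow_add_two, chebRec_adjMatrix_sub hreg, ih₀, trace_sub]
    simp only [hodd]
    ring

lemma eigenvalues_adjMatrix_le {d : ℕ} (hreg : X.IsRegularOfDegree d)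
    (hA : (X.adjMatrix ℝ).IsHermitian) (i : Fin n) : hA.eigenvalues i ≤ d := by
  have hev : Module.End.HasEigenvalue (toLin' (X.adjMatrix ℝ)) (hA.eigenvalues i) := by
    rw [Module.End.hasEigenvalue_iff_mem_spectrum, spectrum_toLin']
    exact hA.eigenvalues_mem_spectrum_real i
  obtain ⟨v, hv⟩ := eigenvalue_mem_ball hev
  have hsum : ∑ j ∈ Finset.univ.erase v, ‖X.adjMatrix ℝ v j‖ ≤ d := by
    calc ∑ j ∈ Finset.univ.erase v, ‖X.adjMatrix ℝ v j‖
        ≤ ∑ j, ‖X.adjMatrix ℝ v j‖ :=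
          Finset.sum_le_sum_of_subset_of_nonneg (Finset.erase_subset _ _) fun _ _ _ => norm_nonneg _
      _ = d := by
          rw [← hreg v]
          simp [SimpleGraph.adjMatrix_apply, apply_ite, SimpleGraph.card_neighborFinset_eq_degree,
            ← SimpleGraph.neighborFinset_eq_filter]
  rw [Metric.mem_closedBall, SimpleGraph.adjMatrix_apply, if_neg X.irrefl, dist_zero_right] at hv
  exact (le_abs_self _).trans (hv.trans hsum)

lemma exists_eigenvalues_adjMatrix_eq {d : ℕ} [NeZero n] (hreg : X.IsRegularOfDegree d)
    (hA : (X.adjMatrix ℝ).IsHermitian) : ∃ i, hA.eigenvalues i = d := by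
  rw [← Set.mem_range, ← hA.spectrum_real_eq_range_eigenvalues, ← spectrum_toLin',
    ← Module.End.hasEigenvalue_iff_mem_spectrum]
  refine Module.End.hasEigenvalue_of_hasEigenvector (x := fun _ => 1)
    ⟨Module.End.mem_eigenspace_iff.2 ?_, fun h => one_ne_zero (congrFun h 0)⟩
  ext v
  simp [toLin'_apply, hreg v]

end Hashimoto

theorem Hk_eq_two_n_sub_one_sub_sum_Tk {q n : ℕ} (hq : 1 ≤ q) (hn : 2 ≤ n)
    (X : SimpleGraph (Fin n)) [DecidableRel X.Adj]
    (hconn : X.Connected) (hreg : X.IsRegularOfDegree (q + 1))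
    (hA : (X.adjMatrix ℝ).IsHermitian)
    (lam : Fin n → ℝ)
    (hperm : ∃ σ : Equiv.Perm (Fin n), ∀ i, lam i = hA.eigenvalues (σ i))
    (hanti : ∀ i j : Fin n, i ≤ j → lam j ≤ lam i)
    (k : ℕ) (hk : 1 ≤ k) :
    Hseq q X k =
      2 * ((n : ℝ) - 1) -
        ∑ i ∈ Finset.univ.filter (fun i : Fin n => (i : ℕ) ≠ 0),
          Tk k ((Real.sqrt q)⁻¹ * lam i) := by
  have : NeZero n := ⟨by omega⟩
  obtain ⟨σ, hσ⟩ := hperm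
  have hlam₀ : lam 0 = q + 1 := by
    apply le_antisymm
    · rw [hσ]
      exact_mod_cast eigenvalues_adjMatrix_le hreg hA (σ 0)
    · obtain ⟨i, hi⟩ := exists_eigenvalues_adjMatrix_eq hreg hA
      have := hanti 0 (σ.symm i) (Fin.zero_le _)
      rw [hσ (σ.symm i), σ.apply_symm_apply, hi] at this
      exact_mod_cast this
  have hs : Real.sqrt q ^ k ≠ 0 := by
    have : (0 : ℝ) < q := by exact_mod_cast hq
    positivity
  have hsq : (q : ℝ) ^ k = Real.sqrt q ^ k * Real.sqrt q ^ k := by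
    rw [← mul_pow, Real.mul_self_sqrt (Nat.cast_nonneg q)]
  have hfilter : Finset.univ.filter (fun i : Fin n => (i : ℕ) ≠ 0) = Finset.univ.erase 0 := by
    ext i
    simp
  have htrace : (chebRec q (X.adjMatrix ℝ) k).trace = Real.sqrt q ^ k * Real.sqrt q ^ k + 1 +
      Real.sqrt q ^ k * ∑ i ∈ Finset.univ.filter (fun i : Fin n => (i : ℕ) ≠ 0),
        Tk k ((Real.sqrt q)⁻¹ * lam i) := by
    rw [trace_chebRec_eq_sum hA, ← Equiv.sum_comp σ, hfilter, Finset.mul_sum, ← hsq,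
      ← chebRec_natCast_add_one, ← hlam₀]
    simp only [← hσ, ← chebRec_eq_sqrt_pow_mul_Tk hq]
    exact (Finset.add_sum_erase _ _ (Finset.mem_univ 0)).symm
  rw [Hseq, Ngc, trace_hashimoto_pow hreg, htrace]
  split_ifs <;> field_simp <;> ring
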